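/- Let G be the simple graph on six vertices v1,...,v6 whose edges are the path edges v1v2, v2v3, v3v4, v4v5, v5v6 together with the chords v1v3, v3v5 and v4v6 (the graph G^6_92). Then the crossing number of the Cartesian product G □ C_3 equals 9. -/

import Mathlib

open SimpleGraph

/-- A drawing of a simple graph in the plane: vertices are mapped to distinct
points, and each edge is mapped to a simple arc (parametrised by `[0,1]`)
joining the images of its endpoints and avoiding the images of all vertices
in its interior. -/
structure Drawing {V : Type*} (G : SimpleGraph V) where
  vertexMap : V → ℝ × ℝ
  vertexMap_injective : Function.Injective vertexMap
  arc : G.edgeSet → ℝ → ℝ × ℝ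
  arc_continuousOn : ∀ e, ContinuousOn (arc e) (Set.Icc 0 1)
  arc_injOn : ∀ e, Set.InjOn (arc e) (Set.Icc 0 1)
  arc_endpoints : ∀ e : G.edgeSet, ∃ u v : V,
    (e : Sym2 V) = s(u, v) ∧ arc e 0 = vertexMap u ∧ arc e 1 = vertexMap v
  arc_avoids_vertices : ∀ e : G.edgeSet, ∀ t ∈ Set.Ioo (0 : ℝ) 1, ∀ w : V,
    arc e t ≠ vertexMap w

/-- The crossings of a drawing: an unordered pair of distinct edges together
with a point of the plane where the two corresponding arcs intersect away
from their endpoints. -/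
def Drawing.crossings {V : Type*} {G : SimpleGraph V} (D : Drawing G) :
    Set (Sym2 G.edgeSet × (ℝ × ℝ)) :=
  { x | ∃ e f : G.edgeSet, e ≠ f ∧ x.1 = s(e, f) ∧
      (∃ s ∈ Set.Ioo (0 : ℝ) 1, D.arc e s = x.2) ∧
      (∃ t ∈ Set.Ioo (0 : ℝ) 1, D.arc f t = x.2) }

/-- The crossing number of a simple graph: the minimum number of crossings
over all drawings of the graph in the plane. -/
noncomputable def crossingNumber {V : Type*} (G : SimpleGraph V) : ℕ :=
  sInf { n : ℕ | ∃ D : Drawing G, D.crossings.Finite ∧ D.crossings.ncard = n }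

/-- The graph `G⁶₉₂`: the path `v1 v2 v3 v4 v5 v6` together with the chords `v1v3`, `v3v5` and `v4v6`. -/
def G6_92 : SimpleGraph (Fin 6) :=
  SimpleGraph.fromEdgeSet {s(0, 1), s(1, 2), s(2, 3), s(3, 4), s(4, 5), s(0, 2), s(2, 4), s(3, 5)}

open scoped unitInterval

instance unitInterval.contractibleSpace : ContractibleSpace I :=
  (convex_Icc (0 : ℝ) 1).contractibleSpace ⟨0, by simp⟩

instance unitInterval.locallyPathConnectedSpace : LocallyPathConnectedSpace I :=
  (convex_Icc (0 : ℝ) 1).locallyPathConnectedSpace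

/-- `c` is the total variation along `[0,1]` of some continuous logarithm of `f`. -/
def HasLogVariation (f : I → ℂ) (c : ℂ) : Prop :=
  ∃ L : C(I, ℂ), (∀ t, Complex.exp (L t) = f t) ∧ L 1 - L 0 = c

theorem exists_continuous_log {A : Type*} [TopologicalSpace A] [SimplyConnectedSpace A]
    [LocallyPathConnectedSpace A] (f : C(A, ℂ)) (hf : ∀ a, f a ≠ 0) :
    ∃ L : C(A, ℂ), ∀ a, Complex.exp (L a) = f a := by
  obtain ⟨a₀⟩ : Nonempty A := inferInstance
  obtain ⟨L, ⟨-, hL⟩, -⟩ := Complex.isCoveringMapOn_exp.existsUnique_continuousMap_lifts f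
    (a₀ := a₀) (e₀ := Complex.log (f a₀)) (Complex.exp_log (hf a₀)) (by simpa using hf)
  exact ⟨L, fun a ↦ congrFun hL a⟩

theorem HasLogVariation.unique {f : I → ℂ} {c d : ℂ} (hc : HasLogVariation f c)
    (hd : HasLogVariation f d) : c = d := by
  obtain ⟨L, hL, rfl⟩ := hc
  obtain ⟨M, hM, rfl⟩ := hd
  have h1 : Complex.exp (L 0 - M 0) = 1 := by
    rw [Complex.exp_sub, hL, hM, div_self]
    rw [← hL]; exact Complex.exp_ne_zero _
  have := (Complex.isCoveringMapOn_exp.existsUnique_continuousMap_lifts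
    (ContinuousMap.comp ⟨Complex.exp, Complex.continuous_exp⟩ L) (a₀ := 0) (e₀ := L 0) rfl
    (by simp)).unique (y₁ := L) (y₂ := M + .const _ (L 0 - M 0)) ⟨rfl, rfl⟩
    ⟨by simp, by ext t; simp [Complex.exp_add, hL, hM, h1]⟩
  have h2 := DFunLike.congr_fun this 1
  simp only [ContinuousMap.add_apply, ContinuousMap.const_apply] at h2
  rw [h2]; ring

open Classical in
/-- The variation of a continuous logarithm of `f` along `[0,1]`, or `0` if there is none. -/
noncomputable def logVariation (f : I → ℂ) : ℂ :=
  if h : ∃ c, HasLogVariation f c then h.choose else 0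

theorem HasLogVariation.logVariation_eq {f : I → ℂ} {c : ℂ} (hc : HasLogVariation f c) :
    logVariation f = c := by
  have h : ∃ c, HasLogVariation f c := ⟨c, hc⟩
  rw [logVariation, dif_pos h]
  exact h.choose_spec.unique hc

theorem exists_logVariation_eq {u v w a b : ℂ} (γ : Path u v) (hw : w ∉ Set.range γ)
    (ha : Complex.exp a = v - w) (hb : Complex.exp b = u - w) :
    ∃ n : ℤ, logVariation (fun t ↦ γ t - w) = a - b + n * (2 * Real.pi * Complex.I) := by
  obtain ⟨L, hL⟩ := exists_continuous_log (A := I) ⟨fun t ↦ γ t - w, by fun_prop⟩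
    (fun t h ↦ hw ⟨t, sub_eq_zero.1 h⟩)
  have h : logVariation (fun t ↦ γ t - w) = L 1 - L 0 :=
    HasLogVariation.logVariation_eq ⟨L, hL, rfl⟩
  have h1 : Complex.exp (L 1 - L 0 - (a - b)) = 1 := by
    have h0 := hL 0
    have h1 := hL 1
    simp only [ContinuousMap.coe_mk, Path.source, Path.target] at h0 h1
    simp only [Complex.exp_sub, h0, h1, ha, hb]
    refine div_self (div_ne_zero ?_ ?_)
    · rw [← ha]; exact Complex.exp_ne_zero _
    · rw [← hb]; exact Complex.exp_ne_zero _
  obtain ⟨n, hn⟩ := Complex.exp_eq_one_iff.1 h1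
  exact ⟨n, by rw [h, ← hn]; ring⟩

/-- Going around the boundary of the square `(s, t) ↦ γ s - δ t`, which avoids the origin when the
paths are disjoint, the logarithm has no variation. -/
theorem logVariation_of_disjoint {u v w x : ℂ} (γ : Path u v) (δ : Path w x)
    (h : Disjoint (Set.range γ) (Set.range δ)) :
    logVariation (fun t ↦ γ t - w) + logVariation (fun t ↦ δ t - v) =
      logVariation (fun t ↦ γ t - x) + logVariation (fun t ↦ δ t - u) := by
  obtain ⟨L, hL⟩ := exists_continuous_log (A := I × I)
    ⟨fun z ↦ γ z.1 - δ z.2, by fun_prop⟩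
    (fun z hz ↦ Set.disjoint_left.1 h ⟨z.1, rfl⟩ ⟨z.2, (sub_eq_zero.1 hz).symm⟩)
  simp only [ContinuousMap.coe_mk] at hL
  have e1 : logVariation (fun t ↦ γ t - w) = L (1, 0) - L (0, 0) :=
    HasLogVariation.logVariation_eq ⟨⟨fun t ↦ L (t, 0), by fun_prop⟩, fun t ↦ by simp [hL], rfl⟩
  have e2 : logVariation (fun t ↦ γ t - x) = L (1, 1) - L (0, 1) :=
    HasLogVariation.logVariation_eq ⟨⟨fun t ↦ L (t, 1), by fun_prop⟩, fun t ↦ by simp [hL], rfl⟩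
  have e3 : logVariation (fun t ↦ δ t - u) = L (0, 1) - L (0, 0) :=
    HasLogVariation.logVariation_eq ⟨⟨fun t ↦ L (0, t) + Real.pi * Complex.I, by fun_prop⟩,
      fun t ↦ by simp [hL, Complex.exp_add], by simp⟩
  have e4 : logVariation (fun t ↦ δ t - v) = L (1, 1) - L (1, 0) :=
    HasLogVariation.logVariation_eq ⟨⟨fun t ↦ L (1, t) + Real.pi * Complex.I, by fun_prop⟩,
      fun t ↦ by simp [hL, Complex.exp_add], by simp⟩
  rw [e1, e2, e3, e4]; ring

/-- A choice of logarithms of the differences of a finite family of distinct points which is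
antisymmetric up to a summand `π * I`. -/
theorem exists_log_sub (p : Fin 3 → ℂ) (hp : ∀ i k, i ≠ k → p i ≠ p k) :
    ∃ ℓ : Fin 3 → Fin 3 → ℂ, (∀ i k, i ≠ k → Complex.exp (ℓ i k) = p i - p k) ∧
      ∀ i k, i < k → ℓ k i = ℓ i k + Real.pi * Complex.I := by
  refine ⟨fun i k ↦ if i < k then Complex.log (p i - p k) else
    Complex.log (p k - p i) + Real.pi * Complex.I, fun i k h ↦ ?_, fun i k h ↦ ?_⟩
  · dsimp only
    split_ifs
    · exact Complex.exp_log (sub_ne_zero.2 (hp i k h))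
    · rw [Complex.exp_add, Complex.exp_log (sub_ne_zero.2 (hp k i h.symm)), Complex.exp_pi_mul_I]
      ring
  · simp [h, h.not_gt]

/-- Whenever the nine edges of `K₃,₃` are mapped to paths in the plane, some two paths that
correspond to edges without a common vertex meet. -/
theorem not_disjoint_of_K33 (p q : Fin 3 → ℂ) (γ : ∀ i j, Path (p i) (q j)) :
    ∃ i k j l, i ≠ k ∧ j ≠ l ∧ ¬ Disjoint (Set.range (γ i j)) (Set.range (γ k l)) := by
  by_contra! H
  have other : ∀ i : Fin 3, ∃ k, k ≠ i := by decide
  have hs : ∀ i j, p i ∈ Set.range (γ i j) := fun i j ↦ ⟨0, (γ i j).source⟩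
  have ht : ∀ i j, q j ∈ Set.range (γ i j) := fun i j ↦ ⟨1, (γ i j).target⟩
  have hp' : ∀ i k j, i ≠ k → p k ∉ Set.range (γ i j) := fun i k j h hk ↦ by
    obtain ⟨l, hl⟩ := other j
    exact Set.disjoint_left.1 (H i k j l h hl.symm) hk (hs k l)
  have hq' : ∀ i j l, j ≠ l → q l ∉ Set.range (γ i j) := fun i j l h hl ↦ by
    obtain ⟨k, hk⟩ := other i
    exact Set.disjoint_left.1 (H i k j l hk.symm h) hl (ht k l)
  have hpq : ∀ i j, p i ≠ q j := fun i j h ↦ by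
    obtain ⟨k, hk⟩ := other i
    exact hp' k i j hk (by rw [h]; exact ht k j)
  obtain ⟨P, hP, hP'⟩ := exists_log_sub p fun i k h e ↦ hp' i k 0 h (by rw [← e]; exact hs i 0)
  obtain ⟨Q, hQ, hQ'⟩ := exists_log_sub q fun j l h e ↦ hq' 0 j l h (by rw [← e]; exact ht 0 j)
  have hA : ∀ i j, Complex.exp (Complex.log (p i - q j)) = p i - q j := fun i j ↦
    Complex.exp_log (sub_ne_zero.2 (hpq i j))
  have hB : ∀ i j, Complex.exp (Complex.log (p i - q j) + Real.pi * Complex.I) = q j - p i :=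
    fun i j ↦ by rw [Complex.exp_add, hA, Complex.exp_pi_mul_I]; ring
  have hm : ∀ k i j, ∃ n : ℤ, i ≠ k → logVariation (fun t ↦ γ i j t - p k) =
      Complex.log (p k - q j) + Real.pi * Complex.I - P i k + n * (2 * Real.pi * Complex.I) :=
    fun k i j ↦ by
      by_cases h : i = k
      · exact ⟨0, fun h' ↦ (h' h).elim⟩
      · obtain ⟨n, hn⟩ := exists_logVariation_eq (γ i j) (hp' i k j h) (hB k j) (hP i k h)
        exact ⟨n, fun _ ↦ hn⟩
  have hn : ∀ l i j, ∃ n : ℤ, j ≠ l → logVariation (fun t ↦ γ i j t - q l) =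
      Q j l - Complex.log (p i - q l) + n * (2 * Real.pi * Complex.I) :=
    fun l i j ↦ by
      by_cases h : j = l
      · exact ⟨0, fun h' ↦ (h' h).elim⟩
      · obtain ⟨n, hn⟩ := exists_logVariation_eq (γ i j) (hq' i j l h) (hQ j l h) (hA i l)
        exact ⟨n, fun _ ↦ hn⟩
  choose m hm using hm
  choose n hn using hn
  have hpi : (2 * Real.pi * Complex.I : ℂ) ≠ 0 := Complex.two_pi_I_ne_zero
  have key : ∀ i k j l, i < k → j ≠ l →
      m k i j + n j k l - n l i j - m i k l + (if j < l then 1 else 0) = 0 := by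
    intro i k j l hik hjl
    have e := logVariation_of_disjoint (γ i j) (γ k l) (H i k j l hik.ne hjl)
    rw [hm k i j hik.ne, hn j k l hjl.symm, hn l i j hjl, hm i k l hik.ne', hP' i k hik] at e
    have e' : ((m k i j + n j k l - n l i j - m i k l + (if j < l then 1 else 0) : ℤ) : ℂ) *
        (2 * Real.pi * Complex.I) = 0 := by
      rcases hjl.lt_or_gt with h | h
      · rw [hQ' j l h] at e
        rw [if_pos h]; push_cast
        linear_combination e
      · rw [hQ' l j h] at e
        rw [if_neg h.not_gt]; push_cast
        linear_combination e
    exact_mod_cast (mul_eq_zero.1 e').resolve_right hpi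
  have key' : ∀ i k, i < k → ∀ j l, j ≠ l →
      m k i j + n j k l - n l i j - m i k l + (if j < l then 1 else 0) = 0 :=
    fun i k h j l h' ↦ key i k j l h h'
  simp only [Fin.forall_fin_succ, Fin.isValue] at key'
  simp at key'
  omega

namespace Drawing

variable {V : Type*} {G : SimpleGraph V} (D : Drawing G)

/-- Two edges of a drawing cross if their arcs have a common interior point. -/
def Cross (e f : G.edgeSet) : Prop :=
  ∃ s ∈ Set.Ioo (0 : ℝ) 1, ∃ t ∈ Set.Ioo (0 : ℝ) 1, D.arc e s = D.arc f t

variable {D} in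
theorem Cross.exists_mem_crossings {e f : G.edgeSet} (h : D.Cross e f) (hef : e ≠ f) :
    ∃ x ∈ D.crossings, x.1 = s(e, f) := by
  obtain ⟨s, hs, t, ht, hst⟩ := h
  exact ⟨(s(e, f), D.arc e s), ⟨e, f, hef, rfl, ⟨s, hs, rfl⟩, t, ht, hst.symm⟩, rfl⟩

theorem joinedIn_arc {e : G.edgeSet} {u v : V} (h : (e : Sym2 V) = s(u, v)) :
    JoinedIn (D.arc e '' Set.Icc 0 1) (D.vertexMap u) (D.vertexMap v) := by
  have hc : IsPathConnected (D.arc e '' Set.Icc 0 1) :=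
    ((convex_Icc (0 : ℝ) 1).isPathConnected ⟨0, by simp⟩).image' (D.arc_continuousOn e)
  have h0 : D.arc e 0 ∈ D.arc e '' Set.Icc 0 1 := ⟨0, by simp, rfl⟩
  have h1 : D.arc e 1 ∈ D.arc e '' Set.Icc 0 1 := ⟨1, by simp, rfl⟩
  obtain ⟨u', v', huv, hu, hv⟩ := D.arc_endpoints e
  rw [hu] at h0
  rw [hv] at h1
  rw [h, Sym2.eq_iff] at huv
  obtain ⟨rfl, rfl⟩ | ⟨rfl, rfl⟩ := huv
  · exact hc.joinedIn _ h0 _ h1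
  · exact hc.joinedIn _ h1 _ h0

theorem arc_mem_cases (e : G.edgeSet) {t : ℝ} (ht : t ∈ Set.Icc (0 : ℝ) 1) :
    t ∈ Set.Ioo (0 : ℝ) 1 ∨ ∃ v ∈ (e : Sym2 V), D.arc e t = D.vertexMap v := by
  obtain ⟨u, v, huv, hu, hv⟩ := D.arc_endpoints e
  rcases eq_or_lt_of_le ht.1 with rfl | h0
  · exact .inr ⟨u, by simp [huv], hu⟩
  rcases eq_or_lt_of_le ht.2 with rfl | h1
  · exact .inr ⟨v, by simp [huv], hv⟩
  exact .inl ⟨h0, h1⟩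

theorem disjoint_arc {e f : G.edgeSet} (h : ∀ v ∈ (e : Sym2 V), v ∉ (f : Sym2 V))
    (hc : ¬ D.Cross e f) :
    Disjoint (D.arc e '' Set.Icc 0 1) (D.arc f '' Set.Icc 0 1) := by
  rw [Set.disjoint_left]
  rintro _ ⟨s, hs, rfl⟩ ⟨t, ht, hst⟩
  rcases D.arc_mem_cases e hs with hs | ⟨u, hu, hu'⟩ <;>
    rcases D.arc_mem_cases f ht with ht | ⟨v, hv, hv'⟩
  · exact hc ⟨s, hs, t, ht, hst.symm⟩
  · exact D.arc_avoids_vertices e s hs v (hst.symm.trans hv')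
  · exact D.arc_avoids_vertices f t ht u (hst.trans hu')
  · obtain rfl := D.vertexMap_injective (hu'.symm.trans (hst.symm.trans hv'))
    exact h _ hu hv

theorem joinedIn_of_transGen {S : Set G.edgeSet} {u v : V}
    (h : Relation.TransGen (fun u v ↦ ∃ e ∈ S, (e : Sym2 V) = s(u, v)) u v) :
    JoinedIn (⋃ e ∈ S, D.arc e '' Set.Icc 0 1) (D.vertexMap u) (D.vertexMap v) := by
  have hsub : ∀ e ∈ S, D.arc e '' Set.Icc 0 1 ⊆ ⋃ e ∈ S, D.arc e '' Set.Icc 0 1 :=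
    fun e he ↦ Set.subset_biUnion_of_mem (u := fun e ↦ D.arc e '' Set.Icc 0 1) he
  induction h with
  | single h => obtain ⟨e, he, h⟩ := h; exact (D.joinedIn_arc h).mono (hsub e he)
  | tail _ h ih => obtain ⟨e, he, h⟩ := h; exact ih.trans ((D.joinedIn_arc h).mono (hsub e he))

/-- If a graph contains a subdivision of `K₃,₃`, whose subdivided edges are the paths with edge sets
`S i j`, then in each drawing two edges on independent paths cross. -/
theorem exists_cross_of_K33 (p q : Fin 3 → V) (S : Fin 3 → Fin 3 → Set G.edgeSet)
    (hS : ∀ i j, Relation.TransGen (fun u v ↦ ∃ e ∈ S i j, (e : Sym2 V) = s(u, v)) (p i) (q j))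
    (hd : ∀ i k j l, i ≠ k → j ≠ l → ∀ e ∈ S i j, ∀ f ∈ S k l, ∀ v ∈ (e : Sym2 V),
      v ∉ (f : Sym2 V)) :
    ∃ i k j l, i ≠ k ∧ j ≠ l ∧ ∃ e ∈ S i j, ∃ f ∈ S k l, D.Cross e f := by
  by_contra! H
  let φ : (ℝ × ℝ) ≃L[ℝ] ℂ := Complex.equivRealProdCLM.symm
  have hJ := fun i j ↦ D.joinedIn_of_transGen (hS i j)
  obtain ⟨i, k, j, l, hik, hjl, h⟩ := not_disjoint_of_K33 (fun i ↦ φ (D.vertexMap (p i)))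
    (fun j ↦ φ (D.vertexMap (q j))) fun i j ↦ (hJ i j).somePath.map φ.continuous
  obtain ⟨x, ⟨s, rfl⟩, t, ht⟩ := Set.not_disjoint_iff.1 h
  have hs := (hJ i j).somePath_mem s
  rw [← show (hJ k l).somePath t = (hJ i j).somePath s from φ.injective (by simpa using ht)] at hs
  have ht := (hJ k l).somePath_mem t
  simp only [Set.mem_iUnion] at hs ht
  obtain ⟨e, he, hs⟩ := hs
  obtain ⟨f, hf, ht⟩ := ht
  exact Set.disjoint_left.1 (D.disjoint_arc (hd i k j l hik hjl e he f hf)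
    (H i k j l hik hjl e he f hf)) hs ht

/-- A lower bound on the number of crossings from a fractional packing of subdivisions of `K₃,₃`. -/
theorem card_le_mul_ncard_crossings (hfin : D.crossings.Finite) {ι : Type*} [Fintype ι]
    {c : ℕ}
    (p q : ι → Fin 3 → V) (S : ι → Fin 3 → Fin 3 → Set G.edgeSet)
    (hS : ∀ n i j, Relation.TransGen (fun u v ↦ ∃ e ∈ S n i j, (e : Sym2 V) = s(u, v))
      (p n i) (q n j))
    (hd : ∀ n i k j l, i ≠ k → j ≠ l → ∀ e ∈ S n i j, ∀ f ∈ S n k l, ∀ v ∈ (e : Sym2 V),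
      v ∉ (f : Sym2 V))
    (hc : ∀ e f : G.edgeSet,
      {n | ∃ i k j l, i ≠ k ∧ j ≠ l ∧ e ∈ S n i j ∧ f ∈ S n k l}.ncard ≤ c) :
    Fintype.card ι ≤ c * D.crossings.ncard := by
  classical
  have key : ∀ n, ∃ x ∈ D.crossings, ∃ e f, x.1 = s(e, f) ∧
      ∃ i k j l, i ≠ k ∧ j ≠ l ∧ e ∈ S n i j ∧ f ∈ S n k l := by
    intro n
    obtain ⟨i, k, j, l, hik, hjl, e, he, f, hf, h⟩ :=
      D.exists_cross_of_K33 (p n) (q n) (S n) (hS n) (hd n)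
    have hef : e ≠ f := by
      rintro rfl
      obtain ⟨u, v, huv, -⟩ := D.arc_endpoints e
      exact hd n i k j l hik hjl e he e hf u (by simp [huv]) (by simp [huv])
    obtain ⟨x, hx, hxe⟩ := h.exists_mem_crossings hef
    exact ⟨x, hx, e, f, hxe, i, k, j, l, hik, hjl, he, hf⟩
  choose x hx hxS using key
  rw [Set.ncard_eq_toFinset_card _ hfin, ← Finset.card_univ]
  refine Finset.card_le_mul_card_image_of_maps_to (f := x) (fun n _ ↦ by simpa using hx n) c fun y _ ↦ ?_
  obtain h | ⟨m, hm⟩ := (Finset.univ.filter fun n ↦ x n = y).eq_empty_or_nonempty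
  · simp [h]
  obtain ⟨e, f, hy, -⟩ := hxS m
  rw [(Finset.mem_filter.1 hm).2] at hy
  refine le_trans ?_ (hc e f)
  rw [← Set.ncard_coe_finset]
  refine Set.ncard_le_ncard (fun n hn ↦ ?_) (Set.toFinite _)
  obtain ⟨e', f', hy', i, k, j, l, hik, hjl, he, hf⟩ := hxS n
  have hn : x n = y := by simpa using hn
  rw [hn, hy, Sym2.eq_iff] at hy'
  obtain ⟨rfl, rfl⟩ | ⟨rfl, rfl⟩ := hy'
  · exact ⟨i, k, j, l, hik, hjl, he, hf⟩
  · exact ⟨k, i, l, j, hik.symm, hjl.symm, hf, he⟩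

end Drawing

section Orientation

variable {R : Type*} [CommRing R]

/-- Twice the signed area of the triangle with vertices `a`, `b` and `c`. -/
def orientation (a b c : R × R) : R :=
  (b.1 - a.1) * (c.2 - a.2) - (b.2 - a.2) * (c.1 - a.1)

theorem orientation_swap (a b c : R × R) : orientation b a c = -orientation a b c := by
  simp only [orientation]; ring

theorem orientation_combo {a b c d : R × R} {s t : R} (h : s + t = 1) :
    orientation a b (s • c + t • d) = s * orientation a b c + t * orientation a b d := by
  obtain rfl := eq_sub_of_add_eq h
  simp only [orientation, Prod.fst_add, Prod.snd_add, Prod.smul_fst, Prod.smul_snd, smul_eq_mul]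
  ring

/-- The points `c` and `d` are on the same side of the line through `a` and `b`. One of them may
lie on this line. -/
def Separated [LE R] (a b c d : R × R) : Prop :=
  0 ≤ orientation a b c * orientation a b d ∧ (orientation a b c ≠ 0 ∨ orientation a b d ≠ 0)

instance [LE R] [DecidableLE R] [DecidableEq R] (a b c d : R × R) :
    Decidable (Separated a b c d) := inferInstanceAs (Decidable (_ ∧ _))

theorem orientation_eq_zero_of_mem_openSegment {a b x : ℝ × ℝ} (h : x ∈ openSegment ℝ a b) :
    orientation a b x = 0 := by
  obtain ⟨s, t, -, -, h, rfl⟩ := h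
  rw [orientation_combo h]
  simp only [orientation]; ring

theorem Separated.disjoint_openSegment {a b c d : ℝ × ℝ} (h : Separated a b c d) :
    Disjoint (openSegment ℝ a b) (openSegment ℝ c d) := by
  rw [Set.disjoint_left]
  rintro x hx ⟨s, t, hs, ht, hst, rfl⟩
  have h0 := orientation_eq_zero_of_mem_openSegment hx
  rw [orientation_combo hst] at h0
  obtain ⟨h, hcd⟩ := h
  set o₁ := orientation a b c
  set o₂ := orientation a b d
  have h1 : s * o₁ ^ 2 + t * (o₁ * o₂) = 0 := by linear_combination o₁ * h0
  have h2 : t * o₂ ^ 2 + s * (o₁ * o₂) = 0 := by linear_combination o₂ * h0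
  have h3 := mul_nonneg hs.le h
  have h4 := mul_nonneg ht.le h
  rcases hcd with hc | hc
  · have := mul_pos hs (sq_pos_of_ne_zero hc)
    linarith
  · have := mul_pos ht (sq_pos_of_ne_zero hc)
    linarith

theorem openSegment_inter_subsingleton {a b c d : ℝ × ℝ}
    (h : orientation a b c ≠ orientation a b d) :
    (openSegment ℝ a b ∩ openSegment ℝ c d).Subsingleton := by
  rintro _ ⟨hx, s, t, -, -, hst, rfl⟩ _ ⟨hy, s', t', -, -, hst', rfl⟩
  replace hx := orientation_eq_zero_of_mem_openSegment hx
  replace hy := orientation_eq_zero_of_mem_openSegment hy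
  rw [orientation_combo hst] at hx
  rw [orientation_combo hst'] at hy
  have hs : s = s' := by
    have : (s - s') * (orientation a b c - orientation a b d) = 0 := by
      linear_combination hx - hy - orientation a b d * (hst - hst')
    exact sub_eq_zero.1 ((mul_eq_zero.1 this).resolve_right (sub_ne_zero.2 h))
  obtain rfl := eq_sub_of_add_eq' hst
  obtain rfl := eq_sub_of_add_eq' hst'
  rw [hs]

end Orientation

namespace Drawing

variable {V : Type*} {G : SimpleGraph V} (pos : V → ℝ × ℝ) (hpos : Function.Injective pos)
  (h : ∀ u v w, G.Adj u v → pos w ∉ openSegment ℝ (pos u) (pos v))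

/-- The drawing of a graph whose edges are straight line segments. -/
noncomputable def straightLine : Drawing G where
  vertexMap := pos
  vertexMap_injective := hpos
  arc e := AffineMap.lineMap (pos (Quot.out e.1).1) (pos (Quot.out e.1).2)
  arc_continuousOn _ := AffineMap.lineMap_continuous.continuousOn
  arc_injOn e := by
    refine (AffineMap.lineMap_injective ℝ fun he ↦ ?_).injOn
    have := e.2
    rw [← Quot.out_eq e.1] at this
    exact G.ne_of_adj this (hpos he)
  arc_endpoints e := ⟨_, _, (Quot.out_eq e.1).symm, AffineMap.lineMap_apply_zero _ _,
    AffineMap.lineMap_apply_one _ _⟩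
  arc_avoids_vertices e t ht w hw := by
    have he := e.2
    rw [← Quot.out_eq e.1] at he
    refine h _ _ w he ?_
    rw [← hw, openSegment_eq_image_lineMap]
    exact ⟨t, ht, rfl⟩

theorem straightLine_arc_mem {e : G.edgeSet} {u v : V} (he : (e : Sym2 V) = s(u, v)) {t : ℝ}
    (ht : t ∈ Set.Ioo (0 : ℝ) 1) :
    (straightLine pos hpos h).arc e t ∈ openSegment ℝ (pos u) (pos v) := by
  have hm : (straightLine pos hpos h).arc e t ∈
      openSegment ℝ (pos (Quot.out e.1).1) (pos (Quot.out e.1).2) := by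
    rw [openSegment_eq_image_lineMap]
    exact ⟨t, ht, rfl⟩
  have h' : s((Quot.out e.1).1, (Quot.out e.1).2) = s(u, v) := (Quot.out_eq e.1).trans he
  rw [Sym2.eq_iff] at h'
  obtain ⟨h₁, h₂⟩ | ⟨h₁, h₂⟩ := h'
  · rwa [h₁, h₂] at hm
  · rwa [h₁, h₂, openSegment_symm] at hm

end Drawing

theorem G6_92_adj_iff {u v : Fin 6} : G6_92.Adj u v ↔ s(u, v) ∈ ([s(0, 1), s(1, 2), s(2, 3),
    s(3, 4), s(4, 5), s(0, 2), s(2, 4), s(3, 5)] : List (Sym2 (Fin 6))) := by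
  simp only [G6_92, fromEdgeSet_adj, Set.mem_insert_iff, Set.mem_singleton_iff, List.mem_cons,
    List.not_mem_nil, or_false, and_iff_left_iff_imp]
  revert u v
  decide

instance : DecidableRel G6_92.Adj := fun _ _ ↦ decidable_of_iff' _ G6_92_adj_iff

instance : DecidableRel (G6_92 □ cycleGraph 3).Adj := fun _ _ ↦ decidable_of_iff' _ boxProd_adj

namespace G6_92BoxProdC3

/-- The endpoints of the edges of `G6_92 □ cycleGraph 3`. -/
def edgeList : List ((Fin 6 × Fin 3) × (Fin 6 × Fin 3)) :=
  [((0, 0), (0, 1)), ((0, 0), (0, 2)), ((0, 0), (1, 0)), ((0, 0), (2, 0)), ((0, 1), (0, 2)),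
   ((0, 1), (1, 1)), ((0, 1), (2, 1)), ((0, 2), (1, 2)), ((0, 2), (2, 2)), ((1, 0), (1, 1)),
   ((1, 0), (1, 2)), ((1, 0), (2, 0)), ((1, 1), (1, 2)), ((1, 1), (2, 1)), ((1, 2), (2, 2)),
   ((2, 0), (2, 1)), ((2, 0), (2, 2)), ((2, 0), (3, 0)), ((2, 0), (4, 0)), ((2, 1), (2, 2)),
   ((2, 1), (3, 1)), ((2, 1), (4, 1)), ((2, 2), (3, 2)), ((2, 2), (4, 2)), ((3, 0), (3, 1)),
   ((3, 0), (3, 2)), ((3, 0), (4, 0)), ((3, 0), (5, 0)), ((3, 1), (3, 2)), ((3, 1), (4, 1)),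
   ((3, 1), (5, 1)), ((3, 2), (4, 2)), ((3, 2), (5, 2)), ((4, 0), (4, 1)), ((4, 0), (4, 2)),
   ((4, 0), (5, 0)), ((4, 1), (4, 2)), ((4, 1), (5, 1)), ((4, 2), (5, 2)), ((5, 0), (5, 1)),
   ((5, 0), (5, 2)), ((5, 1), (5, 2))]

/-- The first endpoint of the `a`-th edge. -/
def src (a : Fin 42) : Fin 6 × Fin 3 := (edgeList.getD a default).1

/-- The second endpoint of the `a`-th edge. -/
def dst (a : Fin 42) : Fin 6 × Fin 3 := (edgeList.getD a default).2

theorem adj_src_dst : ∀ a, (G6_92 □ cycleGraph 3).Adj (src a) (dst a) := by decide +kernel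

theorem exists_eq_of_adj : ∀ u v, (G6_92 □ cycleGraph 3).Adj u v →
    ∃ a, s(src a, dst a) = s(u, v) := by decide +kernel

theorem eq_of_ends_eq : ∀ a b, s(src a, dst a) = s(src b, dst b) → a = b := by decide +kernel

/-- The enumeration of the edges. -/
noncomputable def edgeEquiv : Fin 42 ≃ (G6_92 □ cycleGraph 3).edgeSet :=
  .ofBijective (fun a ↦ ⟨s(src a, dst a), adj_src_dst a⟩)
    ⟨fun a b h ↦ eq_of_ends_eq a b (congrArg Subtype.val h), fun ⟨e, he⟩ ↦ by
      induction e with | _ u v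
      obtain ⟨a, ha⟩ := exists_eq_of_adj u v he
      exact ⟨a, Subtype.ext ha⟩⟩

theorem coe_edgeEquiv (a : Fin 42) : (edgeEquiv a : Sym2 (Fin 6 × Fin 3)) = s(src a, dst a) := rfl

/-- Codes of 36 subdivisions of `K₃,₃`: the `a`-th decimal digit of a code is `3 * i + j + 1` if
the `a`-th edge lies on the path between the branch vertices number `i` and `j` of the two sides
(`i, j ∈ {0, 1, 2}`), and `0` if that edge is unused. -/
def codeList : List ℕ :=
  [90007680065300227410, 90070860056023027401, 97606805307410220, 70090805606027403021,
   79066850743010202, 70009085660740203012, 65689007032024710, 56869070200324701,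
   60005600897034712020, 50006807690204700321, 60050060879470312002, 50060087609472000312,
   96865020700003210044040000000000000000000, 69685002007003201400440000000000000000000,
   906802650703210000040004040000000000000000, 609600852003207001400000440000000000000000,
   960082605327010000000404004000000000000000, 690060825320007010004000404000000000000000,
   400045020400000210876000396000000000000000, 400405002004000201608700369000000000000000,
   40002450400210000870396006000000000000000, 40400052000204001600368709000000000000000,
   4002405024010000038796060000000000000000, 4040025020004010036068790000000000000000,
   96700310806050220400440000000000000000000, 69070301608050202044040000000000000000000,
   906731000800226050400000440000000000000000, 609030701600208052040004040000000000000000,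
   960371000028026005004000404000000000000000, 690300710026008025000404004000000000000000,
   400400010004050220780603096000000000000000, 400040001400050202067803069000000000000000,
   40401000000224050783090606000000000000000, 40000401400200052063067809000000000000000,
   4041000020024005307890660000000000000000, 4000410024000025300667890000000000000000]

/-- The branch vertices of the 36 subdivisions, three for either side. -/
def branchList : List (List (Fin 6 × Fin 3)) :=
  [[(0, 2), (1, 0), (2, 1), (0, 0), (1, 1), (2, 2)],
   [(0, 1), (1, 0), (2, 2), (0, 0), (1, 2), (2, 1)],
   [(0, 2), (1, 1), (2, 0), (0, 1), (1, 0), (2, 2)],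
   [(0, 0), (1, 1), (2, 2), (0, 1), (1, 2), (2, 0)],
   [(0, 1), (1, 2), (2, 0), (0, 2), (1, 0), (2, 1)],
   [(0, 0), (1, 2), (2, 1), (0, 2), (1, 1), (2, 0)],
   [(0, 2), (2, 0), (1, 1), (0, 0), (2, 1), (1, 2)],
   [(0, 1), (2, 0), (1, 2), (0, 0), (2, 2), (1, 1)],
   [(0, 2), (2, 1), (1, 0), (0, 1), (2, 0), (1, 2)],
   [(0, 0), (2, 1), (1, 2), (0, 1), (2, 2), (1, 0)],
   [(0, 1), (2, 2), (1, 0), (0, 2), (2, 0), (1, 1)],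
   [(0, 0), (2, 2), (1, 1), (0, 2), (2, 1), (1, 0)],
   [(3, 0), (4, 1), (5, 2), (3, 2), (4, 2), (5, 0)],
   [(3, 0), (4, 2), (5, 1), (3, 1), (4, 1), (5, 0)],
   [(3, 1), (4, 0), (5, 2), (3, 2), (4, 2), (5, 1)],
   [(3, 1), (4, 2), (5, 0), (3, 0), (4, 0), (5, 1)],
   [(3, 2), (4, 0), (5, 1), (3, 1), (4, 1), (5, 2)],
   [(3, 2), (4, 1), (5, 0), (3, 0), (4, 0), (5, 2)],
   [(3, 0), (4, 1), (2, 2), (3, 2), (4, 2), (2, 0)],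
   [(3, 0), (4, 2), (2, 1), (3, 1), (4, 1), (2, 0)],
   [(3, 1), (4, 0), (2, 2), (3, 2), (4, 2), (2, 1)],
   [(3, 1), (4, 2), (2, 0), (3, 0), (4, 0), (2, 1)],
   [(3, 2), (4, 0), (2, 1), (3, 1), (4, 1), (2, 2)],
   [(3, 2), (4, 1), (2, 0), (3, 0), (4, 0), (2, 2)],
   [(4, 0), (3, 1), (5, 2), (4, 2), (3, 2), (5, 0)],
   [(4, 0), (3, 2), (5, 1), (4, 1), (3, 1), (5, 0)],
   [(4, 1), (3, 0), (5, 2), (4, 2), (3, 2), (5, 1)],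
   [(4, 1), (3, 2), (5, 0), (4, 0), (3, 0), (5, 1)],
   [(4, 2), (3, 0), (5, 1), (4, 1), (3, 1), (5, 2)],
   [(4, 2), (3, 1), (5, 0), (4, 0), (3, 0), (5, 2)],
   [(4, 0), (3, 1), (2, 2), (4, 2), (3, 2), (2, 0)],
   [(4, 0), (3, 2), (2, 1), (4, 1), (3, 1), (2, 0)],
   [(4, 1), (3, 0), (2, 2), (4, 2), (3, 2), (2, 1)],
   [(4, 1), (3, 2), (2, 0), (4, 0), (3, 0), (2, 1)],
   [(4, 2), (3, 0), (2, 1), (4, 1), (3, 1), (2, 2)],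
   [(4, 2), (3, 1), (2, 0), (4, 0), (3, 0), (2, 2)]]

/-- The digit describing the role of the `a`-th edge in the `n`-th subdivision. -/
def digit (n : Fin 36) (a : Fin 42) : ℕ := codeList.getD n 0 / 10 ^ (a : ℕ) % 10

/-- The branch vertex number `i` of the `n`-th subdivision. -/
def branch (n : Fin 36) (i : ℕ) : Fin 6 × Fin 3 := (branchList.getD n []).getD i default

/-- Two digits describe independent paths of a subdivision of `K₃,₃`. -/
def Indep (x y : ℕ) : Prop := x ≠ 0 ∧ y ≠ 0 ∧ (x + 2) / 3 ≠ (y + 2) / 3 ∧ x % 3 ≠ y % 3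

instance (x y : ℕ) : Decidable (Indep x y) := inferInstanceAs (Decidable (_ ∧ _))

theorem Indep.symm {x y : ℕ} (h : Indep x y) : Indep y x :=
  ⟨h.2.1, h.1, h.2.2.1.symm, h.2.2.2.symm⟩

theorem card_indep_le (a b : Fin 42) :
    (Finset.univ.filter fun n ↦ Indep (digit n a) (digit n b)).card ≤ 4 := by
  have key : ∀ a b, a ≤ b →
      (Finset.univ.filter fun n ↦ Indep (digit n a) (digit n b)).card ≤ 4 := by
    decide +kernel
  rcases le_total a b with h | h
  · exact key a b h
  · refine le_trans (Finset.card_le_card fun n hn ↦ ?_) (key b a h)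
    simpa using (Finset.mem_filter.1 hn).2.symm

theorem not_indep : ∀ a b,
    src a = src b ∨ src a = dst b ∨ dst a = src b ∨ dst a = dst b →
    ∀ n, ¬ Indep (digit n a) (digit n b) := by
  decide +kernel

/-- There is a walk from `u` to `t` of length between `1` and `k` along edges with digit `d`. -/
def hasWalk (n : Fin 36) (d : ℕ) (t : Fin 6 × Fin 3) : ℕ → Fin 6 × Fin 3 → Bool
  | 0, _ => false
  | k + 1, u => (List.finRange 42).any fun a ↦ digit n a == d &&
      (src a == u && (dst a == t || hasWalk n d t k (dst a)) ||
        dst a == u && (src a == t || hasWalk n d t k (src a)))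

theorem hasWalk_branch : ∀ n, ∀ i j : Fin 3,
    hasWalk n (3 * i + j + 1) (branch n (j + 3)) 4 (branch n i) = true := by
  decide +kernel

theorem transGen_of_hasWalk {n : Fin 36} {d : ℕ} {t : Fin 6 × Fin 3} :
    ∀ {k u}, hasWalk n d t k u = true →
      Relation.TransGen (fun u v ↦ ∃ a, digit n a = d ∧ s(src a, dst a) = s(u, v)) u t
  | k + 1, u, h => by
    simp only [hasWalk, List.any_eq_true, Bool.and_eq_true, Bool.or_eq_true, beq_iff_eq] at h
    obtain ⟨a, -, ha, ⟨rfl, rfl | h⟩ | ⟨rfl, rfl | h⟩⟩ := h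
    · exact .single ⟨a, ha, rfl⟩
    · exact .head ⟨a, ha, rfl⟩ (transGen_of_hasWalk h)
    · exact .single ⟨a, ha, Sym2.eq_swap⟩
    · exact .head ⟨a, ha, Sym2.eq_swap⟩ (transGen_of_hasWalk h)

theorem nine_le_ncard_crossings (D : Drawing (G6_92 □ cycleGraph 3)) (hfin : D.crossings.Finite) :
    9 ≤ D.crossings.ncard := by
  have hdig : ∀ i j k l : Fin 3, i ≠ k → j ≠ l →
      Indep (3 * i + j + 1) (3 * k + l + 1) := by decide
  have h := D.card_le_mul_ncard_crossings hfin (c := 4) (fun (n : Fin 36) (i : Fin 3) ↦ branch n i)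
    (fun n (j : Fin 3) ↦ branch n (j + 3))
    (fun n i j ↦ {e | digit n (edgeEquiv.symm e) = 3 * i + j + 1}) ?_ ?_ ?_
  · rw [Fintype.card_fin] at h
    lia
  · refine fun n i j ↦ Relation.TransGen.mono ?_ _ _
      (transGen_of_hasWalk (hasWalk_branch n i j))
    rintro u v ⟨a, ha, huv⟩
    exact ⟨edgeEquiv a, by simpa using ha, huv⟩
  · intro n i k j l hik hjl e he f hf v hve hvf
    obtain ⟨a, rfl⟩ := edgeEquiv.surjective e
    obtain ⟨b, rfl⟩ := edgeEquiv.surjective f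
    simp only [Set.mem_ofPred_eq, Equiv.symm_apply_apply] at he hf
    simp only [coe_edgeEquiv, Sym2.mem_iff] at hve hvf
    refine not_indep a b (by grind) n ?_
    rw [he, hf]
    exact hdig i j k l hik hjl
  · intro e f
    refine le_trans ?_ (card_indep_le (edgeEquiv.symm e) (edgeEquiv.symm f))
    rw [← Set.ncard_coe_finset]
    refine Set.ncard_le_ncard ?_ (Set.toFinite _)
    rintro n ⟨i, k, j, l, hik, hjl, he, hf⟩
    simp only [Set.mem_ofPred_eq] at he hf
    simpa [he, hf] using hdig i j k l hik hjl

/-- The positions of the vertices in a drawing with straight edges. -/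
def position (v : Fin 6 × Fin 3) : ℤ × ℤ :=
  List.getD
  [(12, 7), (11, 9), (10, 4), (11, 4), (8, 3), (13, 1), (15, 0), (13, 15), (6, 3), (1, 0), (0, 10),
   (8, 10), (5, 1), (11, 14), (6, 5), (4, 7), (1, 8), (4, 8)]
    (3 * v.1 + v.2) 0

/-- The pairs of edges that cross in the drawing given by `position`. -/
def crossingPairs : List (Fin 42 × Fin 42) :=
  [(5, 8), (7, 9), (8, 13), (22, 33), (22, 36), (23, 33), (25, 35), (25, 38), (28, 37)]

theorem position_injective : Function.Injective position := by
  have : ∀ u v, position u = position v → u = v := by decide +kernel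
  exact fun u v h ↦ this u v h

theorem orientation_position_ne_zero : ∀ a v, v ≠ src a → v ≠ dst a →
    orientation (position (src a)) (position (dst a)) (position v) ≠ 0 := by
  decide +kernel

theorem separated_position : ∀ a b, a < b → (a, b) ∉ crossingPairs →
    Separated (position (src a)) (position (dst a)) (position (src b)) (position (dst b)) ∨
    Separated (position (src b)) (position (dst b)) (position (src a)) (position (dst a)) := by
  decide +kernel

theorem orientation_ne_of_mem_crossingPairs : ∀ x ∈ crossingPairs,
    orientation (position (src x.1)) (position (dst x.1)) (position (src x.2)) ≠
    orientation (position (src x.1)) (position (dst x.1)) (position (dst x.2)) := by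
  decide +kernel

/-- The position of a vertex, as a point of the real plane. -/
def point (v : Fin 6 × Fin 3) : ℝ × ℝ := ((position v).1, (position v).2)

theorem orientation_point (u v w : Fin 6 × Fin 3) : orientation (point u) (point v) (point w) =
    (orientation (position u) (position v) (position w) : ℤ) := by
  simp [orientation, point]

theorem point_injective : Function.Injective point := fun u v h ↦ position_injective <| by
  simpa [point, Prod.ext_iff] using h

theorem point_notMem_openSegment {u v w : Fin 6 × Fin 3} (h : (G6_92 □ cycleGraph 3).Adj u v) :
    point w ∉ openSegment ℝ (point u) (point v) := by
  obtain ⟨a, ha⟩ := exists_eq_of_adj u v h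
  intro hw
  have hne : ∀ z, (z = u ∨ z = v) → w ≠ z := by
    rintro z hz rfl
    rcases hz with rfl | rfl
    · exact h.ne (point_injective (left_mem_openSegment_iff.1 hw))
    · exact h.ne (point_injective (right_mem_openSegment_iff.1 hw))
  have h0 := orientation_eq_zero_of_mem_openSegment hw
  rw [orientation_point, Int.cast_eq_zero] at h0
  rw [Sym2.eq_iff] at ha
  obtain ⟨rfl, rfl⟩ | ⟨rfl, rfl⟩ := ha
  · exact orientation_position_ne_zero a w (hne _ (.inl rfl)) (hne _ (.inr rfl)) h0
  · refine orientation_position_ne_zero a w (hne _ (.inr rfl)) (hne _ (.inl rfl)) ?_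
    rw [orientation_swap, h0, neg_zero]

/-- A drawing of `G6_92 □ cycleGraph 3` with nine crossings. -/
noncomputable def nineCrossingsDrawing : Drawing (G6_92 □ cycleGraph 3) :=
  .straightLine point point_injective fun _ _ _ h ↦ point_notMem_openSegment h

theorem disjoint_openSegment {a b : Fin 42} (hab : a < b) (h : (a, b) ∉ crossingPairs) :
    Disjoint (openSegment ℝ (point (src a)) (point (dst a)))
      (openSegment ℝ (point (src b)) (point (dst b))) := by
  have key : ∀ u v w x, Separated (position u) (position v) (position w) (position x) →
      Disjoint (openSegment ℝ (point u) (point v)) (openSegment ℝ (point w) (point x)) := by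
    refine fun u v w x h ↦ Separated.disjoint_openSegment ?_
    rw [Separated, orientation_point, orientation_point]
    exact_mod_cast h
  exact (separated_position a b hab h).elim (key _ _ _ _) fun h ↦ (key _ _ _ _ h).symm

theorem subsingleton_inter_openSegment {a b : Fin 42} (h : (a, b) ∈ crossingPairs) :
    (openSegment ℝ (point (src a)) (point (dst a)) ∩
      openSegment ℝ (point (src b)) (point (dst b))).Subsingleton := by
  apply openSegment_inter_subsingleton
  rw [orientation_point, orientation_point]
  exact_mod_cast orientation_ne_of_mem_crossingPairs _ h

theorem nineCrossingsDrawing_crossings : nineCrossingsDrawing.crossings.Finite ∧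
    nineCrossingsDrawing.crossings.ncard ≤ 9 := by
  classical
  have key : ∀ x ∈ nineCrossingsDrawing.crossings, ∃ ab ∈ crossingPairs,
      x.1 = s(edgeEquiv ab.1, edgeEquiv ab.2) ∧
      x.2 ∈ openSegment ℝ (point (src ab.1)) (point (dst ab.1)) ∩
        openSegment ℝ (point (src ab.2)) (point (dst ab.2)) := by
    rintro ⟨z, y⟩ ⟨e, f, hef, rfl, ⟨s, hs, he⟩, t, ht, hf⟩
    obtain ⟨a, rfl⟩ := edgeEquiv.surjective e
    obtain ⟨b, rfl⟩ := edgeEquiv.surjective f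
    replace he : _ = y := he
    replace hf : _ = y := hf
    have ha : y ∈ openSegment ℝ (point (src a)) (point (dst a)) :=
      he ▸ Drawing.straightLine_arc_mem _ _ _ (coe_edgeEquiv a) hs
    have hb : y ∈ openSegment ℝ (point (src b)) (point (dst b)) :=
      hf ▸ Drawing.straightLine_arc_mem _ _ _ (coe_edgeEquiv b) ht
    rcases lt_or_gt_of_ne (ne_of_apply_ne _ hef) with hab | hab
    · refine ⟨(a, b), ?_, rfl, ha, hb⟩
      by_contra h
      exact Set.disjoint_left.1 (disjoint_openSegment hab h) ha hb
    · refine ⟨(b, a), ?_, Sym2.eq_swap, hb, ha⟩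
      by_contra h
      exact Set.disjoint_left.1 (disjoint_openSegment hab h) hb ha
  let T : Finset (Sym2 (G6_92 □ cycleGraph 3).edgeSet) :=
    crossingPairs.toFinset.image fun ab ↦ s(edgeEquiv ab.1, edgeEquiv ab.2)
  have hT : T.card ≤ 9 := Finset.card_image_le.trans (List.toFinset_card_le _)
  have hmaps : Set.MapsTo Prod.fst nineCrossingsDrawing.crossings (T : Set (Sym2 _)) := by
    intro x hx
    obtain ⟨ab, hab, h, -⟩ := key x hx
    simp only [T, Finset.coe_image, List.coe_toFinset]
    exact ⟨ab, hab, h.symm⟩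
  have hinj : Set.InjOn Prod.fst nineCrossingsDrawing.crossings := by
    intro x hx y hy hxy
    obtain ⟨⟨a, b⟩, hab, h, hx⟩ := key x hx
    obtain ⟨⟨c, d⟩, hcd, h', hy⟩ := key y hy
    refine Prod.ext hxy (subsingleton_inter_openSegment hab hx ?_)
    rw [h, h', Sym2.eq_iff] at hxy
    simp only [EmbeddingLike.apply_eq_iff_eq] at hxy
    obtain ⟨rfl, rfl⟩ | ⟨rfl, rfl⟩ := hxy
    · exact hy
    · exact hy.symm
  refine ⟨.of_injOn hmaps hinj T.finite_toSet, ?_⟩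
  calc _ ≤ (T : Set (Sym2 _)).ncard :=
    Set.ncard_le_ncard_of_injOn _ (fun _ h ↦ hmaps h) hinj T.finite_toSet
    _ ≤ 9 := by rwa [Set.ncard_coe_finset]

end G6_92BoxProdC3

/-- The crossing number of `G⁶₉₂ □ C₃` is `9`. -/
theorem crossingNumber_G6_92_boxProd_C3 :
    crossingNumber (G6_92 □ SimpleGraph.cycleGraph 3) = 9 := by
  obtain ⟨hfin, hle⟩ := G6_92BoxProdC3.nineCrossingsDrawing_crossings
  unfold crossingNumber
  refine le_antisymm (le_trans (Nat.sInf_le ⟨_, hfin, rfl⟩) hle) ?_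
  refine le_csInf ⟨_, _, hfin, rfl⟩ ?_
  rintro _ ⟨D, hD, rfl⟩
  exact G6_92BoxProdC3.nine_le_ncard_crossings D hD
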